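/- Let γ ≥ 2 be a countable ordinal and Σ a finite alphabet containing a letter 0. If there exists a Π⁰_γ-complete (respectively, Σ⁰_γ-complete) ω-language L ⊆ Σ^ω accepted by a real-time Büchi 1-counter automaton, then there exists an infinitary rational relation R ⊆ Γ^ω × Γ^ω (where Γ = Σ ∪ {A}) such that: exactly one section of R is nontrivial, namely R_{α₀} = {σ ∈ Γ^ω : (σ, α₀) ∈ R} is a Π⁰_γ-complete (respectively, Σ⁰_γ-complete) subset of Γ^ω, and for every u ∈ Γ^ω with u ≠ α₀ the section R_u = {σ ∈ Γ^ω : (σ, u) ∈ R} is equal to Γ^ω. -/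

import Mathlib

universe u

/-- We equip `Option σ` (the alphabet `Γ = Σ ∪ {A}`, with `A = none`) with the
discrete topology. -/
instance instTopOption (σ : Type u) : TopologicalSpace (Option σ) := ⊥
instance instDiscreteOption (σ : Type u) : DiscreteTopology (Option σ) := ⟨rfl⟩

/-- Auxiliary function for the coding map `h`: reads position `i` inside the
concatenation of the blocks `A·0^(n+1)·x(n), A·0^(n+2)·x(n+1), ...`. -/
def hAux {σ : Type u} (z : σ) (x : ℕ → σ) : ℕ → ℕ → Option σ
  | _, 0 => none
  | n, (i+1) =>
    if i + 1 ≤ n + 1 then some z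
    else if i + 1 = n + 2 then some (x n)
    else hAux z x (n+1) (i + 1 - (n+3))
  termination_by n i => i
  decreasing_by omega

/-- The coding map `h : Σ^ω → Γ^ω`,
`h(x) = A·0·x(1)·A·0²·x(2)·A·0³·x(3)···A·0ⁿ·x(n)···` (ω-words indexed by `ℕ`). -/
def hmap {σ : Type u} (z : σ) (x : ℕ → σ) : ℕ → Option σ := fun i => hAux z x 0 i

/-- Auxiliary function for the ω-word `α₀`. -/
def aAux {σ : Type u} (z : σ) : ℕ → ℕ → Option σ
  | _, 0 => none
  | n, (i+1) =>
    if i + 1 ≤ n + 1 then some z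
    else aAux z (n+1) (i + 1 - (n+2))
  termination_by n i => i
  decreasing_by omega

/-- The ω-word `α₀ = A·0·A·0²·A·0³···A·0ⁿ···` over `Γ = Σ ∪ {A}`. -/
def alphaWord {σ : Type u} (z : σ) : ℕ → Option σ := fun i => aAux z 0 i

/-- The Borel hierarchy on a topological space `X`: `SigmaPi X α true` is the class
`Σ⁰_α` and `SigmaPi X α false` is the class `Π⁰_α`.  `Σ⁰_1` is the class of open
sets, `Π⁰_1` is the class of closed sets, and for `α ≥ 2`, `Σ⁰_α` (resp. `Π⁰_α`)
is the class of countable unions (resp. intersections) of sets in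
`⋃_{γ < α} Π⁰_γ` (resp. `⋃_{γ < α} Σ⁰_γ`). -/
def SigmaPi (X : Type u) [TopologicalSpace X] (α : Ordinal.{0}) (b : Bool) : Set (Set X) :=
  {s | (α = 1 ∧ ((b = true ∧ IsOpen s) ∨ (b = false ∧ IsClosed s)))
    ∨ (α ≠ 1 ∧ ∃ f : ℕ → Set X,
        (∀ n : ℕ, ∃ γ : Ordinal.{0}, ∃ _ : γ < α, f n ∈ SigmaPi X γ !b) ∧
        s = if b then ⋃ n, f n else ⋂ n, f n)}
  termination_by α
  decreasing_by assumption

/-- The class `Σ⁰_α` of the Borel hierarchy on `X`. -/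
abbrev Sigma0 (X : Type u) [TopologicalSpace X] (α : Ordinal.{0}) : Set (Set X) :=
  SigmaPi X α true

/-- The class `Π⁰_α` of the Borel hierarchy on `X`. -/
abbrev Pi0 (X : Type u) [TopologicalSpace X] (α : Ordinal.{0}) : Set (Set X) :=
  SigmaPi X α false

/-- `F ⊆ Σ^ω` is `Σ⁰_α`-complete (for `b = true`), resp. `Π⁰_α`-complete (for
`b = false`), iff for every nonempty finite alphabet `Y` and every `E ⊆ Y^ω`
(with `Y^ω` carrying the Cantor topology, i.e. the product of the discrete
topology): `E ∈ Σ⁰_α` (resp. `Π⁰_α`) iff `E = f⁻¹(F)` for some continuous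
`f : Y^ω → Σ^ω`. -/
def IsCompleteFor (b : Bool) (α : Ordinal.{0}) {σ : Type} [TopologicalSpace σ]
    (F : Set (ℕ → σ)) : Prop :=
  ∀ (Y : Type), Fintype Y → Nonempty Y → ∀ E : Set (ℕ → Y),
    letI : TopologicalSpace Y := ⊥
    (E ∈ SigmaPi (ℕ → Y) α b ↔
      ∃ f : (ℕ → Y) → (ℕ → σ), Continuous f ∧ E = f ⁻¹' F)

/-- The infinite concatenation of the finite words `u 0, u 1, u 2, ...` equals the
ω-word `x`: every finite partial concatenation is a prefix of `x`, and the total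
length is infinite. -/
def JoinsTo {α : Type u} (u : ℕ → List α) (x : ℕ → α) : Prop :=
  (∀ N : ℕ, ∃ n : ℕ, N ≤ (((List.range n).map u).flatten).length) ∧
  (∀ (n i : ℕ) (h : i < (((List.range n).map u).flatten).length),
      (((List.range n).map u).flatten)[i]'h = x i)

/-- A 2-tape Büchi automaton with input alphabet `σ` and output alphabet `γ`:
a finite set of states `Q`, a finite set `trans ⊆ Q × σ^⋆ × γ^⋆ × Q` of
transitions, an initial state `init` and a set `acc` of accepting states. -/
structure TwoTapeBuchi (σ γ : Type u) where
  Q : Type u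
  finQ : Finite Q
  trans : Set (Q × List σ × List γ × Q)
  finTrans : trans.Finite
  init : Q
  acc : Set Q

/-- The pair `(x, y)` of ω-words is accepted by the 2-tape Büchi automaton `T`
iff it is the pair of input and output words of some successful computation. -/
def TwoTapeBuchi.Accepts {σ γ : Type u} (T : TwoTapeBuchi σ γ)
    (x : ℕ → σ) (y : ℕ → γ) : Prop :=
  ∃ (q : ℕ → T.Q) (u : ℕ → List σ) (v : ℕ → List γ),
    q 0 = T.init ∧
    (∀ n : ℕ, (q n, u n, v n, q (n+1)) ∈ T.trans) ∧
    (∃ qf ∈ T.acc, ∀ n : ℕ, ∃ m : ℕ, n ≤ m ∧ q m = qf) ∧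
    JoinsTo u x ∧ JoinsTo v y

/-- `R ⊆ Σ^ω × Γ^ω` is an infinitary rational relation iff it is the relation
accepted by some 2-tape Büchi automaton. -/
def IsRatRel {σ γ : Type u} (R : Set ((ℕ → σ) × (ℕ → γ))) : Prop :=
  ∃ T : TwoTapeBuchi σ γ, ∀ p : (ℕ → σ) × (ℕ → γ), p ∈ R ↔ T.Accepts p.1 p.2

/-- A real-time Büchi 1-counter automaton: transitions are in
`Q × σ × Bool × Q × ℤ` with the counter move in `{-1, 0, 1}`, and a zero test
(`false` means the counter is zero) which forbids decrementing a zero counter. -/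
structure OneCounterBuchi (σ : Type u) where
  Q : Type u
  finQ : Finite Q
  trans : Set (Q × σ × Bool × Q × ℤ)
  transMoves : ∀ t ∈ trans, t.2.2.2.2 = -1 ∨ t.2.2.2.2 = 0 ∨ t.2.2.2.2 = 1
  transZero : ∀ t ∈ trans, t.2.2.1 = false → t.2.2.2.2 = 0 ∨ t.2.2.2.2 = 1
  init : Q
  acc : Set Q

/-- One computation step of a 1-counter automaton on letter `a`, from
configuration `p` to configuration `p'`. -/
def OneCounterBuchi.Step {σ : Type u} (M : OneCounterBuchi σ) (a : σ)
    (p p' : M.Q × ℕ) : Prop :=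
  ∃ j : ℤ, (p.1, a, (p.2 ≠ 0 : Bool), p'.1, j) ∈ M.trans ∧ (p'.2 : ℤ) = (p.2 : ℤ) + j

/-- The ω-word `x` is accepted by the real-time Büchi 1-counter automaton `M`:
there is a run on `x` starting in `(q₀, 0)` in which some accepting state occurs
infinitely often. -/
def OneCounterBuchi.Accepts {σ : Type u} (M : OneCounterBuchi σ) (x : ℕ → σ) : Prop :=
  ∃ r : ℕ → M.Q × ℕ,
    r 0 = (M.init, 0) ∧
    (∀ i : ℕ, M.Step (x i) (r i) (r (i+1))) ∧
    ∃ qf ∈ M.acc, ∀ n : ℕ, ∃ m : ℕ, n ≤ m ∧ (r m).1 = qf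

/-- The identification of a pair of ω-words with an ω-word over the product
alphabet. -/
def pairToWord {a b : Type u} (p : (ℕ → a) × (ℕ → b)) : ℕ → a × b :=
  fun n => (p.1 n, p.2 n)

/-! ### Topological part -/

theorem sigmaPi_union_open_true {X : Type} [TopologicalSpace X] [TopologicalSpace.MetrizableSpace X]
    {γ : Ordinal.{0}} (hγ : 2 ≤ γ) {E U : Set X} (hE : E ∈ SigmaPi X γ true) (hU : IsOpen U) :
    E ∪ U ∈ SigmaPi X γ true := by
  let _ := TopologicalSpace.metrizableSpaceMetric X
  have h1 : (1 : Ordinal.{0}) < γ := lt_of_lt_of_le one_lt_two hγ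
  obtain ⟨F, hF, -, hFU, -⟩ := hU.exists_iUnion_isClosed
  rw [SigmaPi] at hE ⊢
  rcases hE with ⟨h, -⟩ | ⟨-, f, hf, rfl⟩
  · exact absurd h h1.ne'
  · refine Or.inr ⟨h1.ne', fun n => if n % 2 = 0 then f (n / 2) else F (n / 2), ?_, ?_⟩
    · intro n
      by_cases hn : n % 2 = 0
      · simpa [hn] using hf (n / 2)
      · refine ⟨1, h1, ?_⟩
        rw [SigmaPi]
        left
        simp [hn, hF]
    · ext x
      simp only [← hFU, if_true, Set.mem_union, Set.mem_iUnion]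
      constructor
      · rintro (⟨n, hn⟩ | ⟨n, hn⟩)
        · refine ⟨2 * n, ?_⟩
          simpa using hn
        · refine ⟨2 * n + 1, ?_⟩
          have h3 : (2 * n + 1) / 2 = n := by omega
          have h4 : ¬ ((2 * n + 1) % 2 = 0) := by omega
          rw [if_neg h4, h3]
          exact hn
      · rintro ⟨n, hn⟩
        split_ifs at hn with h
        · exact Or.inl ⟨_, hn⟩
        · exact Or.inr ⟨_, hn⟩

theorem sigmaPi_union_open {X : Type} [TopologicalSpace X] [TopologicalSpace.MetrizableSpace X]
    {γ : Ordinal.{0}} (hγ : 2 ≤ γ) {b : Bool} {E U : Set X} (hE : E ∈ SigmaPi X γ b)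
    (hU : IsOpen U) : E ∪ U ∈ SigmaPi X γ b := by
  cases b with
  | true => exact sigmaPi_union_open_true hγ hE hU
  | false =>
    have h1 : (1 : Ordinal.{0}) < γ := lt_of_lt_of_le one_lt_two hγ
    rw [SigmaPi] at hE ⊢
    rcases hE with ⟨h, -⟩ | ⟨-, f, hf, rfl⟩
    · exact absurd h h1.ne'
    · refine Or.inr ⟨h1.ne', fun n => f n ∪ U, ?_, ?_⟩
      · intro n
        obtain ⟨δ, hδ, hfn⟩ := hf n
        refine ⟨δ, hδ, ?_⟩
        simp only [Bool.not_false] at hfn ⊢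
        rcases lt_trichotomy δ 1 with h0 | h0 | h0
        · exfalso
          have h00 : δ = 0 := by simpa [Order.lt_one_iff] using h0
          subst h00
          rw [SigmaPi] at hfn
          rcases hfn with ⟨h, -⟩ | ⟨-, g, hg, -⟩
          · exact absurd h h0.ne
          · obtain ⟨ε, hε, -⟩ := hg 0
            exact absurd hε (not_lt.mpr zero_le)
        · subst h0
          rw [SigmaPi] at hfn ⊢
          left
          rcases hfn with ⟨-, h⟩ | ⟨h, -⟩
          · simp at h
            simpa using h.union hU
          · exact absurd rfl h
        · refine sigmaPi_union_open_true ?_ hfn hU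
          have := Order.add_one_le_of_lt h0
          rwa [one_add_one_eq_two] at this
      · simp [Set.iInter_union]

theorem complete_transfer {σ : Type} [Fintype σ]
    [TopologicalSpace σ] [DiscreteTopology σ] 
    {γ : Ordinal.{0}} (hγ : 2 ≤ γ) (b : Bool) {L : Set (ℕ → σ)} (hL : IsCompleteFor b γ L)
    (h : (ℕ → σ) → (ℕ → Option σ)) (k : (ℕ → Option σ) → (ℕ → σ)) (hh : Continuous h)
    (hk : Continuous k) (hkh : ∀ x, k (h x) = x) (S : Set (ℕ → Option σ))
    (hS : ∀ x, h x ∈ S ↔ x ∈ L) (hS' : ∀ y, y ∉ Set.range h → y ∈ S) :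
    IsCompleteFor b γ S := by
  intro Y hY hne E
  letI : TopologicalSpace Y := ⊥
  haveI : DiscreteTopology Y := ⟨rfl⟩
  constructor
  · intro hE
    obtain ⟨f, hf, rfl⟩ := (hL Y hY hne E).1 hE
    refine ⟨h ∘ f, hh.comp hf, ?_⟩
    ext y
    simp [hS]
  · rintro ⟨f, hf, rfl⟩
    have hcl : IsClosed (Set.range h) := (isCompact_range hh).isClosed
    have h1 : (k ∘ f) ⁻¹' L ∈ SigmaPi (ℕ → Y) γ b :=
      (hL Y hY hne _).2 ⟨k ∘ f, hk.comp hf, rfl⟩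
    have h2 := sigmaPi_union_open hγ h1 (hcl.isOpen_compl.preimage hf)
    convert h2 using 1
    ext y
    simp only [Set.mem_preimage, Set.mem_union, Function.comp, Set.mem_compl_iff]
    by_cases hy : f y ∈ Set.range h
    · obtain ⟨x, hx⟩ := hy
      rw [← hx, hkh, hS]
      simp
    · simp [hS' _ hy, hy]

/-! ### Runs of 2-tape automata, by head positions -/

/-- `l` is the factor of the ω-word `x` at position `p`. -/
def Reads {α : Type} (x : ℕ → α) : ℕ → List α → Prop
  | _, [] => True
  | p, a :: l => x p = a ∧ Reads x (p + 1) l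

theorem reads_iff {α : Type} (x : ℕ → α) (l : List α) : ∀ p : ℕ,
    Reads x p l ↔ ∀ (i : ℕ) (h : i < l.length), l[i]'h = x (p + i) := by
  induction l with
  | nil => intro p; simp [Reads]
  | cons a l ih =>
    intro p
    simp only [Reads, ih]
    constructor
    · rintro ⟨h1, h2⟩ i hi
      cases i with
      | zero => simpa using h1.symm
      | succ i =>
        simp only [List.getElem_cons_succ]
        rw [h2]
        congr 1
        omega
    · intro H
      refine ⟨?_, ?_⟩
      · have h := H 0 (by simp)
        exact h.symm
      · intro i hi
        have := H (i + 1) (by simpa using hi)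
        simp only [List.getElem_cons_succ] at this
        rw [this]
        congr 1
        omega

theorem exists_reads {α : Type} (x : ℕ → α) (m : ℕ) : ∀ p : ℕ,
    ∃ l : List α, l.length = m ∧ Reads x p l := by
  induction m with
  | zero => intro p; exact ⟨[], rfl, trivial⟩
  | succ m ih =>
    intro p
    obtain ⟨l, h1, h2⟩ := ih (p + 1)
    exact ⟨x p :: l, by simp [h1], rfl, h2⟩

theorem reads_append {α : Type} (x : ℕ → α) (l l' : List α) : ∀ p : ℕ,
    Reads x p (l ++ l') ↔ Reads x p l ∧ Reads x (p + l.length) l' := by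
  induction l with
  | nil => intro p; simp [Reads]
  | cons a l ih =>
    intro p
    have : p + (a :: l).length = p + 1 + l.length := by simp; omega
    rw [this]
    simp [Reads, ih, and_assoc]

theorem joinsTo_iff {α : Type} (u : ℕ → List α) (x : ℕ → α) :
    JoinsTo u x ↔ ∃ p : ℕ → ℕ, p 0 = 0 ∧
      (∀ n, p (n + 1) = p n + (u n).length ∧ Reads x (p n) (u n)) ∧ ∀ N, ∃ n, N ≤ p n := by
  have key : ∀ n, ((List.range (n + 1)).map u).flatten
      = ((List.range n).map u).flatten ++ u n := by
    intro n
    simp [List.range_succ]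
  constructor
  · rintro ⟨h1, h2⟩
    refine ⟨fun n => (((List.range n).map u).flatten).length, by simp, ?_, h1⟩
    intro n
    refine ⟨by simp only [key, List.length_append], ?_⟩
    have h3 : Reads x 0 (((List.range (n + 1)).map u).flatten) := by
      rw [reads_iff]
      intro i hi
      rw [h2 (n + 1) i hi]
      simp
    rw [key, reads_append] at h3
    simpa using h3.2
  · rintro ⟨p, h0, h1, h2⟩
    have hR : ∀ n, p n = (((List.range n).map u).flatten).length ∧
        Reads x 0 (((List.range n).map u).flatten) := by
      intro n
      induction n with
      | zero => simp [h0, Reads]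
      | succ n ih =>
        rw [key, reads_append, List.length_append, (h1 n).1, ih.1]
        refine ⟨rfl, ih.2, ?_⟩
        have := (h1 n).2
        rw [ih.1] at this
        simpa using this
    refine ⟨?_, ?_⟩
    · intro N
      obtain ⟨n, hn⟩ := h2 N
      exact ⟨n, (hR n).1 ▸ hn⟩
    · intro n i hi
      have := (reads_iff _ _ _).1 (hR n).2 i hi
      simpa using this

/-- One step between configurations (state, position on tape 1, position on tape 2). -/
def CStep {σ γ : Type} (T : TwoTapeBuchi σ γ) (x : ℕ → σ) (y : ℕ → γ)
    (c c' : T.Q × ℕ × ℕ) : Prop :=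
  ∃ (u : List σ) (v : List γ), (c.1, u, v, c'.1) ∈ T.trans ∧
    Reads x c.2.1 u ∧ Reads y c.2.2 v ∧ c'.2.1 = c.2.1 + u.length ∧ c'.2.2 = c.2.2 + v.length

/-- There is a successful computation from the configuration `c`. -/
def AccFrom {σ γ : Type} (T : TwoTapeBuchi σ γ) (x : ℕ → σ) (y : ℕ → γ)
    (c : T.Q × ℕ × ℕ) : Prop :=
  ∃ d : ℕ → T.Q × ℕ × ℕ, d 0 = c ∧ (∀ n, CStep T x y (d n) (d (n + 1))) ∧
    (∃ qf ∈ T.acc, ∀ n : ℕ, ∃ m : ℕ, n ≤ m ∧ (d m).1 = qf) ∧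
    (∀ N, ∃ n, N ≤ (d n).2.1) ∧ (∀ N, ∃ n, N ≤ (d n).2.2)

theorem accepts_iff {σ γ : Type} (T : TwoTapeBuchi σ γ) (x : ℕ → σ) (y : ℕ → γ) :
    T.Accepts x y ↔ AccFrom T x y (T.init, 0, 0) := by
  constructor
  · rintro ⟨q, u, v, h0, ht, hacc, hu, hv⟩
    obtain ⟨p, p0, p1, p2⟩ := (joinsTo_iff _ _).1 hu
    obtain ⟨r, r0, r1, r2⟩ := (joinsTo_iff _ _).1 hv
    exact ⟨fun n => (q n, p n, r n), by simp [h0, p0, r0],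
      fun n => ⟨u n, v n, ht n, (p1 n).2, (r1 n).2, (p1 n).1, (r1 n).1⟩, hacc, p2, r2⟩
  · rintro ⟨d, h0, hs, hacc, h1, h2⟩
    choose u v ht hu hv hu' hv' using hs
    refine ⟨fun n => (d n).1, u, v, by simp [h0], ht, hacc, ?_, ?_⟩
    · exact (joinsTo_iff _ _).2 ⟨fun n => (d n).2.1, by simp [h0], fun n => ⟨hu' n, hu n⟩, h1⟩
    · exact (joinsTo_iff _ _).2 ⟨fun n => (d n).2.2, by simp [h0], fun n => ⟨hv' n, hv n⟩, h2⟩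

theorem AccFrom.head {σ γ : Type} {T : TwoTapeBuchi σ γ} {x : ℕ → σ} {y : ℕ → γ}
    {c c' : T.Q × ℕ × ℕ} (h : CStep T x y c c') (h' : AccFrom T x y c') : AccFrom T x y c := by
  obtain ⟨d, h0, hs, ⟨qf, hqf, hacc⟩, h1, h2⟩ := h'
  refine ⟨fun n => Nat.casesOn n c d, rfl, ?_, ⟨qf, hqf, ?_⟩, ?_, ?_⟩
  · intro n
    cases n with
    | zero => simpa [h0] using h
    | succ n => exact hs n
  · intro n
    obtain ⟨m, hm, hm'⟩ := hacc n
    exact ⟨m + 1, by omega, hm'⟩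
  · intro N
    obtain ⟨n, hn⟩ := h1 N
    exact ⟨n + 1, hn⟩
  · intro N
    obtain ⟨n, hn⟩ := h2 N
    exact ⟨n + 1, hn⟩

theorem AccFrom.of_path {σ γ : Type} {T : TwoTapeBuchi σ γ} {x : ℕ → σ} {y : ℕ → γ}
    {c c' : T.Q × ℕ × ℕ} (h : Relation.ReflTransGen (CStep T x y) c c')
    (h' : AccFrom T x y c') : AccFrom T x y c := by
  induction h using Relation.ReflTransGen.head_induction_on with
  | refl => exact h'
  | head hs _ ih => exact AccFrom.head hs ih

/-! ### Block structure of `α₀` -/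

/-- Start of the `n`-th block of `α₀`. -/
def blkStart : ℕ → ℕ
  | 0 => 0
  | n + 1 => blkStart n + (n + 2)

/-- Block number and offset of a position. -/
def blkOff : ℕ → ℕ × ℕ
  | 0 => (0, 0)
  | i + 1 => if (blkOff i).2 < (blkOff i).1 + 1 then ((blkOff i).1, (blkOff i).2 + 1)
      else ((blkOff i).1 + 1, 0)

theorem blkOff_spec (i : ℕ) :
    i = blkStart (blkOff i).1 + (blkOff i).2 ∧ (blkOff i).2 < (blkOff i).1 + 2 := by
  induction i with
  | zero => simp [blkOff, blkStart]
  | succ i ih =>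
    rw [blkOff]
    split_ifs with h
    · simp only; omega
    · simp only [blkStart]; omega

theorem exists_blk (i : ℕ) : ∃ n k, k < n + 2 ∧ i = blkStart n + k :=
  ⟨_, _, (blkOff_spec i).2, (blkOff_spec i).1⟩

theorem blkOff_aux (n : ℕ) (h : blkOff (blkStart n) = (n, 0)) (k : ℕ) (hk : k < n + 2) :
    blkOff (blkStart n + k) = (n, k) := by
  induction k with
  | zero => simpa using h
  | succ k ih =>
    rw [← add_assoc, blkOff, ih (by omega)]
    simp only
    rw [if_pos (by omega)]

theorem blkOff_start (n : ℕ) : blkOff (blkStart n) = (n, 0) := by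
  induction n with
  | zero => rfl
  | succ n ih =>
    have := blkOff_aux n ih (n + 1) (by omega)
    rw [blkStart, show blkStart n + (n + 2) = (blkStart n + (n + 1)) + 1 from rfl, blkOff, this]
    simp

theorem blkOff_eq (n k : ℕ) (hk : k < n + 2) : blkOff (blkStart n + k) = (n, k) :=
  blkOff_aux n (blkOff_start n) k hk

theorem le_blkStart (n : ℕ) : n ≤ blkStart n := by
  induction n with
  | zero => simp
  | succ n ih => rw [blkStart]; omega

theorem blkStart_mono : Monotone blkStart :=
  monotone_nat_of_le_succ fun n => by rw [blkStart]; omega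

theorem alpha_shift {σ : Type} (z : σ) (n k : ℕ) :
    alphaWord z (blkStart n + k) = aAux z n k := by
  induction n generalizing k with
  | zero => simp [blkStart, alphaWord]
  | succ n ih =>
    rw [blkStart, add_assoc, ih, show n + 2 + k = (n + 1 + k) + 1 by omega, aAux]
    split_ifs with h
    · omega
    · congr 1; omega

theorem alpha_zero {σ : Type} (z : σ) (n : ℕ) : alphaWord z (blkStart n) = none := by
  have := alpha_shift z n 0
  rwa [aAux, add_zero] at this

theorem alpha_pos {σ : Type} (z : σ) (n k : ℕ) (hk : k < n + 1) :
    alphaWord z (blkStart n + (k + 1)) = some z := by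
  rw [alpha_shift, aAux, if_pos (by omega)]

/-- The coding: replace the letter after the `n`-th `A` of `α₀` by `x n`. -/
def code {σ : Type} (z : σ) (x : ℕ → σ) (i : ℕ) : Option σ :=
  if (blkOff i).2 = 0 then none
  else if (blkOff i).2 = 1 then some (x (blkOff i).1) else some z

/-- The decoding map. -/
def decode {σ : Type} (z : σ) (y : ℕ → Option σ) (n : ℕ) : σ := (y (blkStart n + 1)).getD z

theorem code_zero {σ : Type} (z : σ) (x : ℕ → σ) (n : ℕ) : code z x (blkStart n) = none := by
  rw [code, blkOff_start]; simp

theorem code_one {σ : Type} (z : σ) (x : ℕ → σ) (n : ℕ) :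
    code z x (blkStart n + 1) = some (x n) := by
  rw [code, blkOff_eq _ _ (by omega)]; simp

theorem code_two {σ : Type} (z : σ) (x : ℕ → σ) (n k : ℕ) (hk : k < n) :
    code z x (blkStart n + (k + 2)) = some z := by
  rw [code, blkOff_eq _ _ (by omega)]; simp

theorem decode_code {σ : Type} (z : σ) (x : ℕ → σ) : decode z (code z x) = x := by
  ext n
  simp [decode, code_one]

theorem continuous_code {σ : Type} [TopologicalSpace σ] [DiscreteTopology σ] (z : σ) :
    Continuous (code z) := by
  refine continuous_pi fun i => ?_
  unfold code
  split_ifs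
  · exact continuous_const
  · exact (continuous_of_discreteTopology (f := (some : σ → Option σ))).comp (continuous_apply _)
  · exact continuous_const

theorem continuous_decode {σ : Type} [TopologicalSpace σ] [DiscreteTopology σ] (z : σ) :
    Continuous (decode z) := by
  refine continuous_pi fun i => ?_
  exact (continuous_of_discreteTopology (f := fun o : Option σ => o.getD z)).comp
    (continuous_apply _)

/-! ### The automaton -/

/-- States of the 2-tape automaton. -/
inductive St (Q : Type) : Type
  | start : St Q
  | sync : Bool → St Q
  | skip : St Q
  | cmp : St Q
  | sink : St Q
  | run : Q → St Q
  | test : Q → Bool → St Q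

/-- Transitions of the 2-tape automaton. -/
inductive Tr {σ : Type} (z : σ) (M : OneCounterBuchi σ) :
    St M.Q → List (Option σ) → List (Option σ) → St M.Q → Prop
  | start_sync : Tr z M .start [] [] (.sync false)
  | start_run : Tr z M .start [] [] (.run M.init)
  | start_err (a b c) (h : ¬ (a = none ∧ b = some z ∧ c = none)) :
      Tr z M .start [] [a, b, c] .sink
  | sync (b b' t t') (h : b' = Option.isNone t') : Tr z M (.sync b) [t] [t'] (.sync b')
  | sync_err1 (t') : Tr z M (.sync true) [none] [t'] .sink
  | sync_err2 (t t') (h : t ≠ t') : Tr z M (.sync false) [t] [t'] .sink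
  | guess (b) : Tr z M (.sync b) [none] [none] .skip
  | skip1 (a) : Tr z M .skip [] [some a] .skip
  | skip2 : Tr z M .skip [] [none] .cmp
  | cmp1 (a) : Tr z M .cmp [some a] [some z] .cmp
  | cmp_err1 (t t') (h : t' ≠ some z) : Tr z M .cmp [t] [t'] .sink
  | cmp_err2 (t) (h : t ≠ none) : Tr z M .cmp [none] [some z, t] .sink
  | sink (t t') : Tr z M .sink [t] [t'] .sink
  | scan (q t) : Tr z M (.run q) [some z] [t] (.run q)
  | tst (q b t) (h : b = Option.isSome t) : Tr z M (.run q) [none] [t] (.test q b)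
  | mv (q a i q' j w) (h : (q, a, i, q', j) ∈ M.trans) (hw : (w.length : ℤ) = 1 + j) :
      Tr z M (.test q i) [some a] w (.run q')

theorem St.finite (Q : Type) [Finite Q] : Finite (St Q) := by
  let f : (Bool ⊕ Fin 4) ⊕ (Q ⊕ Q × Bool) → St Q := fun s => match s with
    | .inl (.inl b) => .sync b
    | .inl (.inr 0) => .start
    | .inl (.inr 1) => .skip
    | .inl (.inr 2) => .cmp
    | .inl (.inr 3) => .sink
    | .inr (.inl q) => .run q
    | .inr (.inr (q, b)) => .test q b
  refine Finite.of_surjective f ?_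
  intro s
  cases s with
  | start => exact ⟨.inl (.inr 0), rfl⟩
  | sync b => exact ⟨.inl (.inl b), rfl⟩
  | skip => exact ⟨.inl (.inr 1), rfl⟩
  | cmp => exact ⟨.inl (.inr 2), rfl⟩
  | sink => exact ⟨.inl (.inr 3), rfl⟩
  | run q => exact ⟨.inr (.inl q), rfl⟩
  | test q b => exact ⟨.inr (.inr (q, b)), rfl⟩

theorem Tr.length_le {σ : Type} {z : σ} {M : OneCounterBuchi σ} {q u v q'}
    (h : Tr z M q u v q') : u.length ≤ 3 ∧ v.length ≤ 3 := by
  cases h with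
  | mv q a i q' j w h hw =>
    have := M.transMoves _ h
    simp only at this
    refine ⟨by simp, by omega⟩
  | _ => simp

/-- The 2-tape automaton. -/
def theT {σ : Type} [Fintype σ] (z : σ) (M : OneCounterBuchi σ) :
    TwoTapeBuchi (Option σ) (Option σ) where
  Q := St M.Q
  finQ := haveI := M.finQ; St.finite M.Q
  trans := {t | Tr z M t.1 t.2.1 t.2.2.1 t.2.2.2}
  finTrans := by
    haveI := M.finQ
    haveI := St.finite M.Q
    have h3 := List.finite_length_le (Option σ) 3
    refine ((Set.finite_univ (α := St M.Q)).prod (h3.prod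
      (h3.prod (Set.finite_univ (α := St M.Q))))).subset ?_
    rintro ⟨q, u, v, q'⟩ h
    have := Tr.length_le h
    simpa using this
  init := .start
  acc := {s | s = .sink ∨ ∃ q ∈ M.acc, s = .run q}

section
variable {σ : Type} [Fintype σ] (z : σ) (M : OneCounterBuchi σ)

theorem sink_acc (x y : ℕ → Option σ) (p1 p2 : ℕ) :
    AccFrom (theT z M) x y (St.sink, p1, p2) := by
  refine ⟨fun n => (St.sink, p1 + n, p2 + n), rfl, ?_, ⟨St.sink, Or.inl rfl, ?_⟩, ?_, ?_⟩
  · intro n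
    exact ⟨[x (p1 + n)], [y (p2 + n)], Tr.sink _ _, ⟨rfl, trivial⟩, ⟨rfl, trivial⟩, rfl, rfl⟩
  · intro n; exact ⟨n, le_rfl, rfl⟩
  · intro N; exact ⟨N, by simp⟩
  · intro N; exact ⟨N, by simp⟩

/-- Whether the previous letter is `A`. -/
def flag {α : Type} (y : ℕ → Option α) : ℕ → Bool
  | 0 => false
  | i + 1 => (y i).isNone

theorem sync_reach (x y : ℕ → Option σ) (i : ℕ) :
    Relation.ReflTransGen (CStep (theT z M) x y) (St.start, 0, 0) (St.sync (flag y i), i, i) := by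
  induction i with
  | zero =>
    exact Relation.ReflTransGen.single
      ⟨[], [], Tr.start_sync, trivial, trivial, rfl, rfl⟩
  | succ i ih =>
    exact ih.tail ⟨[x i], [y i], Tr.sync _ _ _ _ rfl, ⟨rfl, trivial⟩, ⟨rfl, trivial⟩, rfl, rfl⟩

theorem skip_reach (x y : ℕ → Option σ) (p1 p2 k : ℕ) (h : ∀ j < k, y (p2 + j) ≠ none) :
    Relation.ReflTransGen (CStep (theT z M) x y) (St.skip, p1, p2) (St.skip, p1, p2 + k) := by
  induction k with
  | zero => exact Relation.ReflTransGen.refl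
  | succ k ih =>
    obtain ⟨a, ha⟩ := Option.ne_none_iff_exists'.1 (h k (by omega))
    exact (ih fun j hj => h j (by omega)).tail
      ⟨[], [some a], Tr.skip1 _, trivial, ⟨ha, trivial⟩, rfl, rfl⟩

theorem cmp_reach (x y : ℕ → Option σ) (p1 p2 k : ℕ) (h : ∀ j < k, x (p1 + j) ≠ none)
    (h' : ∀ j < k, y (p2 + j) = some z) :
    Relation.ReflTransGen (CStep (theT z M) x y) (St.cmp, p1, p2) (St.cmp, p1 + k, p2 + k) := by
  induction k with
  | zero => exact Relation.ReflTransGen.refl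
  | succ k ih =>
    obtain ⟨a, ha⟩ := Option.ne_none_iff_exists'.1 (h k (by omega))
    exact (ih (fun j hj => h j (by omega)) (fun j hj => h' j (by omega))).tail
      ⟨[some a], [some z], Tr.cmp1 _, ⟨ha, trivial⟩, ⟨h' k (by omega), trivial⟩, rfl, rfl⟩

/-- Position `i` of the pair `(s, u)` is as in a pair `(code x, α₀)`. -/
def GoodAt (s u : ℕ → Option σ) (i : ℕ) : Prop :=
  u i = alphaWord z i ∧
    if flag (alphaWord z) i = true then s i ≠ none else s i = alphaWord z i

theorem flag_alpha (n k : ℕ) (hk : k < n + 2) :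
    flag (alphaWord z) (blkStart n + k) = decide (k = 1) := by
  match k, hk with
  | 0, _ =>
    cases n with
    | zero => rfl
    | succ n =>
      rw [blkStart]
      change (alphaWord z (blkStart n + (n + 1))).isNone = _
      rw [alpha_pos z n n (by omega)]
      rfl
  | 1, _ =>
    change (alphaWord z (blkStart n)).isNone = _
    rw [alpha_zero]; rfl
  | k + 2, hk =>
    change (alphaWord z (blkStart n + (k + 1))).isNone = _
    rw [alpha_pos z n k (by omega)]
    simp

theorem good_all (s u : ℕ → Option σ) (h : ∀ i, GoodAt z s u i) :
    u = alphaWord z ∧ s ∈ Set.range (code z) := by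
  refine ⟨funext fun i => (h i).1, decode z s, funext fun i => ?_⟩
  obtain ⟨n, k, hk, rfl⟩ := exists_blk i
  have h2 := (h (blkStart n + k)).2
  rw [flag_alpha z n k hk] at h2
  match k, hk with
  | 0, _ => simp only [add_zero] at *; simp at h2; rw [h2, code_zero, alpha_zero]
  | 1, _ =>
    rw [code_one, decode]
    simp at h2
    obtain ⟨a, ha⟩ := Option.ne_none_iff_exists'.1 h2
    simp [ha]
  | k + 2, hk =>
    rw [code_two z _ n k (by omega)]
    simp at h2
    rw [h2]
    exact (alpha_pos z n (k + 1) (by omega)).symm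

theorem bad_acc (s u : ℕ → Option σ) (i : ℕ) (hb : ¬ GoodAt z s u i)
    (hg : ∀ j < i, GoodAt z s u j) : AccFrom (theT z M) s u (St.start, 0, 0) := by
  by_cases hu : u i = alphaWord z i
  · -- a local mismatch
    have hfl : flag u i = flag (alphaWord z) i := by
      cases i with
      | zero => rfl
      | succ i => simp only [flag]; rw [(hg i (by omega)).1]
    refine AccFrom.of_path ((sync_reach z M s u i).tail ?_) (sink_acc z M s u (i + 1) (i + 1))
    have hb' : ¬ (if flag (alphaWord z) i = true then s i ≠ none else s i = alphaWord z i) :=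
      fun h => hb ⟨hu, h⟩
    rw [← hfl] at hb'
    by_cases hf : flag u i = true
    · rw [if_pos hf] at hb'
      rw [hf]
      exact ⟨[none], [u i], Tr.sync_err1 _, ⟨not_not.1 hb', trivial⟩, ⟨rfl, trivial⟩, rfl, rfl⟩
    · rw [if_neg hf, ← hu] at hb'
      rw [Bool.eq_false_iff.2 hf]
      exact ⟨[s i], [u i], Tr.sync_err2 _ _ hb', ⟨rfl, trivial⟩, ⟨rfl, trivial⟩, rfl, rfl⟩
  · by_cases hi : i < 3
    · refine AccFrom.head ?_ (sink_acc z M s u 0 3)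
      refine ⟨[], [u 0, u 1, u 2], Tr.start_err _ _ _ ?_, trivial, ⟨rfl, rfl, rfl, trivial⟩,
        rfl, rfl⟩
      rintro ⟨h0, h1, h2⟩
      apply hu
      have a0 : alphaWord z 0 = none := alpha_zero z 0
      have a1 : alphaWord z 1 = some z := alpha_pos z 0 0 (by omega)
      have a2 : alphaWord z 2 = none := alpha_zero z 1
      interval_cases i
      · rw [h0, a0]
      · rw [h1, a1]
      · rw [h2, a2]
    · have hdec : ∃ n k, k < n + 3 ∧ i = blkStart (n + 1) + 1 + k := by
        obtain ⟨m, l, hl, rfl⟩ := exists_blk i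
        rcases Nat.eq_zero_or_pos l with rfl | hl0
        · obtain _ | _ | m := m
          · simp [blkStart] at hi
          · simp [blkStart] at hi
          · exact ⟨m, m + 2, by omega, by rw [blkStart]; omega⟩
        · obtain _ | m := m
          · simp [blkStart] at hi; omega
          · exact ⟨m, l - 1, by omega, by omega⟩
      obtain ⟨n, k, hk, rfl⟩ := hdec
      have hst : blkStart (n + 1) = blkStart n + (n + 2) := rfl
      -- facts on the good initial part
      have hu' : ∀ j, j < blkStart (n + 1) + 1 + k → u j = alphaWord z j := fun j hj => (hg j hj).1
      have hsA : ∀ m, blkStart m < blkStart (n + 1) + 1 + k → s (blkStart m) = none := by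
        intro m hm
        have h := (hg _ hm).2
        have h2 := flag_alpha z m 0 (by omega)
        rw [add_zero] at h2
        rw [h2] at h
        simp at h
        rw [h, alpha_zero]
      have hsz : ∀ j, j < n + 1 → s (blkStart n + 1 + j) ≠ none := by
        intro j hj
        have h := (hg (blkStart n + (1 + j)) (by omega)).2
        rw [flag_alpha z n (1 + j) (by omega)] at h
        rw [add_assoc]
        split_ifs at h with hc
        · exact h
        · rw [h, add_comm 1 j, alpha_pos z n j (by omega)]
          simp
      have r1 := sync_reach z M s u (blkStart n)
      have r2 : Relation.ReflTransGen (CStep (theT z M) s u) (St.start, 0, 0)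
          (St.skip, blkStart n + 1, blkStart n + 1) := r1.tail
        ⟨[none], [none], Tr.guess _, ⟨hsA n (by omega), trivial⟩,
          ⟨by
            change u (blkStart n) = none
            rw [hu' _ (by omega), alpha_zero], trivial⟩, rfl, rfl⟩
      have r3 := r2.trans (skip_reach z M s u (blkStart n + 1) (blkStart n + 1) (n + 1) (by
        intro j hj
        rw [hu' _ (by omega), add_assoc, add_comm 1 j, alpha_pos z n j hj]
        simp))
      have r4 : Relation.ReflTransGen (CStep (theT z M) s u) (St.start, 0, 0)
          (St.cmp, blkStart n + 1, blkStart (n + 1) + 1) := r3.tail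
        ⟨[], [none], Tr.skip2, trivial, ⟨by
          change u (blkStart n + 1 + (n + 1)) = none
          rw [show blkStart n + 1 + (n + 1) = blkStart (n + 1) by omega]
          rw [hu' _ (by omega), alpha_zero], trivial⟩, rfl, by
          simp only [List.length_singleton]; omega⟩
      have r5 := fun (k' : ℕ) (hk' : k' ≤ k) (hk'' : k' ≤ n + 1) =>
        r4.trans (cmp_reach z M s u (blkStart n + 1) (blkStart (n + 1) + 1) k'
          (fun j hj => hsz j (by omega)) (fun j hj => by
            rw [hu' _ (by omega), add_assoc, add_comm 1 j, alpha_pos z (n + 1) j (by omega)]))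
      by_cases hkn : k ≤ n + 1
      · refine AccFrom.of_path ((r5 k le_rfl hkn).tail ?_)
          (sink_acc z M s u (blkStart n + 1 + k + 1) (blkStart (n + 1) + 1 + k + 1))
        refine ⟨[s (blkStart n + 1 + k)], [u (blkStart (n + 1) + 1 + k)], Tr.cmp_err1 _ _ ?_,
          ⟨rfl, trivial⟩, ⟨rfl, trivial⟩, rfl, rfl⟩
        rwa [add_assoc (blkStart (n + 1)), add_comm 1 k, alpha_pos z (n + 1) k (by omega),
          ← add_comm 1 k, ← add_assoc] at hu
      · obtain rfl : k = n + 2 := by omega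
        refine AccFrom.of_path ((r5 (n + 1) (by omega) le_rfl).tail ?_)
          (sink_acc z M s u (blkStart n + 1 + (n + 1) + 1) (blkStart (n + 1) + 1 + (n + 1) + 2))
        refine ⟨[none], [some z, u (blkStart (n + 1) + 1 + (n + 1) + 1)], Tr.cmp_err2 _ ?_,
          ⟨?_, trivial⟩, ⟨?_, rfl, trivial⟩, rfl, rfl⟩
        · intro h
          apply hu
          rw [show blkStart (n + 1) + 1 + (n + 2) = blkStart (n + 1) + 1 + (n + 1) + 1 from rfl, h]
          rw [show blkStart (n + 1) + 1 + (n + 1) + 1 = blkStart (n + 2) by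
            have : blkStart (n + 2) = blkStart (n + 1) + (n + 3) := rfl
            omega, alpha_zero]
        · change s (blkStart n + 1 + (n + 1)) = none
          rw [show blkStart n + 1 + (n + 1) = blkStart (n + 1) by omega]
          exact hsA _ (by omega)
        · change u (blkStart (n + 1) + 1 + (n + 1)) = some z
          rw [hu' _ (by omega), add_assoc, add_comm 1 (n + 1),
            alpha_pos z (n + 1) (n + 1) (by omega)]

theorem acc_of_not (s u : ℕ → Option σ) (h : ¬ (u = alphaWord z ∧ s ∈ Set.range (code z))) :
    (theT z M).Accepts s u := by
  rw [accepts_iff]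
  have : ∃ i, ¬ GoodAt z s u i := by
    by_contra hc
    push Not at hc
    exact h (good_all z s u hc)
  classical
  exact bad_acc z M s u (Nat.find this) (Nat.find_spec this)
    fun j hj => not_not.1 (Nat.find_min this hj)

theorem acc_of_M (x : ℕ → σ) (h : M.Accepts x) : (theT z M).Accepts (code z x) (alphaWord z) := by
  rw [accepts_iff]
  obtain ⟨r, h0, hs, qf, hqf, hinf⟩ := h
  have hle : ∀ n, (r n).2 ≤ n := by
    intro n
    induction n with
    | zero => simp [h0]
    | succ n ih =>
      obtain ⟨j, hj, hj'⟩ := hs n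
      have := M.transMoves _ hj
      simp only at this
      omega
  let d : ℕ → St M.Q × ℕ × ℕ := fun i =>
    if (blkOff i).2 = 0 then (.run (r (blkOff i).1).1, i, i + (r (blkOff i).1).2)
    else if (blkOff i).2 = 1 then
      (.test (r (blkOff i).1).1 (decide ((r (blkOff i).1).2 ≠ 0)), i, i + (r (blkOff i).1).2)
    else (.run (r ((blkOff i).1 + 1)).1, i, i + (r ((blkOff i).1 + 1)).2)
  have d0 : ∀ n, d (blkStart n) = (.run (r n).1, blkStart n, blkStart n + (r n).2) := by
    intro n; simp [d, blkOff_start]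
  have d1 : ∀ n, d (blkStart n + 1) = (.test (r n).1 (decide ((r n).2 ≠ 0)), blkStart n + 1,
      blkStart n + 1 + (r n).2) := by
    intro n
    simp only [d]
    rw [blkOff_eq n 1 (by omega)]
    simp
  have d2 : ∀ n k, k ≤ n → d (blkStart n + 2 + k) = (.run (r (n + 1)).1, blkStart n + 2 + k,
      blkStart n + 2 + k + (r (n + 1)).2) := by
    intro n k hk
    rcases hk.eq_or_lt with rfl | hk
    · have := d0 (k + 1)
      rw [blkStart] at this
      rw [show blkStart k + 2 + k = blkStart k + (k + 2) by omega]
      exact this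
    · simp only [d]
      rw [show blkStart n + 2 + k = blkStart n + (k + 2) by omega, blkOff_eq n (k + 2) (by omega)]
      simp
  have dp : ∀ i, (d i).2.1 = i ∧ i ≤ (d i).2.2 := by
    intro i
    simp only [d]
    split_ifs <;> simp
  refine AccFrom.head (c' := (St.run M.init, 0, 0)) ⟨[], [], Tr.start_run, trivial, trivial,
    rfl, rfl⟩ ⟨d, ?_, ?_, ⟨St.run qf, Or.inr ⟨qf, hqf, rfl⟩, ?_⟩, ?_, ?_⟩
  · have := d0 0
    rw [h0] at this
    exact this
  · intro i
    obtain ⟨n, k, hk, rfl⟩ := exists_blk i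
    match k, hk with
    | 0, _ =>
      rw [add_zero, d0, d1]
      refine ⟨[none], [alphaWord z (blkStart n + (r n).2)], Tr.tst _ _ _ ?_,
        ⟨code_zero _ _ _, trivial⟩, ⟨rfl, trivial⟩, rfl, ?_⟩
      · have := hle n
        rcases Nat.eq_zero_or_pos (r n).2 with hc | hc
        · rw [hc, add_zero, alpha_zero]; rfl
        · obtain ⟨c, hc'⟩ := Nat.exists_eq_succ_of_ne_zero hc.ne'
          rw [hc', alpha_pos z n c (by omega)]
          simp
      · simp only [List.length_singleton]; omega
    | 1, _ =>
      rw [d1, show blkStart n + 1 + 1 = blkStart n + 2 + 0 from rfl, d2 n 0 (by omega)]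
      obtain ⟨j, hj, hj'⟩ := hs n
      have hm := M.transMoves _ hj
      simp only at hm
      obtain ⟨w, hw, hw'⟩ := exists_reads (alphaWord z) (1 + j).toNat (blkStart n + 1 + (r n).2)
      refine ⟨[some (x n)], w, Tr.mv _ _ _ _ j w hj (by omega), ⟨code_one _ _ _, trivial⟩, hw',
        rfl, ?_⟩
      simp only
      omega
    | k + 2, hk =>
      rw [show blkStart n + (k + 2) = blkStart n + 2 + k by omega, d2 n k (by omega),
        add_assoc (blkStart n + 2) k 1, d2 n (k + 1) (by omega)]
      refine ⟨[some z], [_], Tr.scan _ _, ⟨?_, trivial⟩, ⟨rfl, trivial⟩, rfl, ?_⟩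
      · change code z x (blkStart n + 2 + k) = some z
        rw [show blkStart n + 2 + k = blkStart n + (k + 2) by omega, code_two z x n k (by omega)]
      · simp only [List.length_singleton]; omega
  · intro n
    obtain ⟨m, hm, hm'⟩ := hinf n
    refine ⟨blkStart m, hm.trans (le_blkStart m), ?_⟩
    rw [d0, hm']
  · intro N; exact ⟨N, (dp N).1.ge⟩
  · intro N; exact ⟨N, (dp N).2⟩

/-- Invariant of the error-searching part of the automaton on `(code x, α₀)`. -/
def ErrInv (c : St M.Q × ℕ × ℕ) : Prop :=
  match c with
  | (.sync b, p1, p2) => p1 = p2 ∧ b = flag (alphaWord z) p1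
  | (.skip, p1, p2) => ∃ n k, k ≤ n + 1 ∧ p1 = blkStart n + 1 ∧ p2 = blkStart n + 1 + k
  | (.cmp, p1, p2) => ∃ n k, k ≤ n + 1 ∧ p1 = blkStart n + 1 + k ∧ p2 = blkStart (n + 1) + 1 + k
  | _ => False

theorem alpha_none (i : ℕ) (h : alphaWord z i = none) : ∃ n, i = blkStart n := by
  obtain ⟨n, k, hk, rfl⟩ := exists_blk i
  cases k with
  | zero => exact ⟨n, rfl⟩
  | succ k => rw [alpha_pos z n k (by omega)] at h; simp at h

theorem goodAt_code (x : ℕ → σ) (i : ℕ) : GoodAt z (code z x) (alphaWord z) i := by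
  refine ⟨rfl, ?_⟩
  obtain ⟨n, k, hk, rfl⟩ := exists_blk i
  rw [flag_alpha z n k hk]
  match k, hk with
  | 0, _ => simp [code_zero, alpha_zero]
  | 1, _ => simp [code_one]
  | k + 2, hk =>
    rw [code_two z x n k (by omega), alpha_pos z n (k + 1) (by omega)]
    simp

theorem ErrInv.step (x : ℕ → σ) (c c' : St M.Q × ℕ × ℕ) (hc : ErrInv z M c)
    (h : CStep (theT z M) (code z x) (alphaWord z) c c') : ErrInv z M c' := by
  obtain ⟨q, p1, p2⟩ := c
  obtain ⟨q', p1', p2'⟩ := c'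
  obtain ⟨u, v, ht, hu, hv, h1, h2⟩ := h
  change Tr z M q u v q' at ht
  simp only at hu hv h1 h2
  have hst : ∀ n, blkStart (n + 1) = blkStart n + (n + 2) := fun n => rfl
  cases ht with
  | start_sync => exact hc.elim
  | start_run => exact hc.elim
  | start_err a b c h => exact hc.elim
  | sync b b' t t' hb =>
    obtain ⟨rfl, hb2⟩ := hc
    obtain ⟨hv, -⟩ := hv
    subst hv
    subst h1 h2
    exact ⟨rfl, hb⟩
  | sync_err1 t' =>
    obtain ⟨rfl, hb2⟩ := hc
    have := (goodAt_code z x p1).2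
    rw [if_pos hb2.symm] at this
    exact this hu.1
  | sync_err2 t t' htt =>
    obtain ⟨rfl, hb2⟩ := hc
    have := (goodAt_code z x p1).2
    rw [← hb2] at this
    simp only [Bool.false_eq_true, if_false] at this
    exact htt (by rw [← hu.1, ← hv.1, this])
  | guess b =>
    obtain ⟨rfl, hb2⟩ := hc
    obtain ⟨n, rfl⟩ := alpha_none z p1 hv.1
    exact ⟨n, 0, by omega, by simpa using h1, by simpa using h2⟩
  | skip1 a =>
    obtain ⟨n, k, hk, rfl, rfl⟩ := hc
    have hk' : k ≠ n + 1 := by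
      rintro rfl
      have := hv.1
      rw [show blkStart n + 1 + (n + 1) = blkStart (n + 1) by have := hst n; omega,
        alpha_zero] at this
      simp at this
    exact ⟨n, k + 1, by omega, by simpa using h1, by simpa [add_assoc] using h2⟩
  | skip2 =>
    obtain ⟨n, k, hk, rfl, rfl⟩ := hc
    have hk' : k = n + 1 := by
      by_contra hne
      have := hv.1
      rw [add_assoc, add_comm 1 k, alpha_pos z n k (by omega)] at this
      simp at this
    subst hk'
    refine ⟨n, 0, by omega, by simpa using h1, ?_⟩
    have := hst n
    simp only [List.length_singleton] at h2
    omega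
  | cmp1 a =>
    obtain ⟨n, k, hk, rfl, rfl⟩ := hc
    have hk' : k ≠ n + 1 := by
      rintro rfl
      have := hu.1
      rw [show blkStart n + 1 + (n + 1) = blkStart (n + 1) by have := hst n; omega,
        code_zero] at this
      simp at this
    exact ⟨n, k + 1, by omega, by simpa [add_assoc] using h1, by simpa [add_assoc] using h2⟩
  | cmp_err1 t t' h =>
    obtain ⟨n, k, hk, rfl, rfl⟩ := hc
    apply h
    rw [← hv.1, add_assoc, add_comm 1 k, alpha_pos z (n + 1) k (by omega)]
  | cmp_err2 t h =>
    obtain ⟨n, k, hk, rfl, rfl⟩ := hc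
    have hk' : k = n + 1 := by
      by_contra hne
      have := hu.1
      obtain _ | k := k
      · rw [add_zero, code_one] at this
        simp at this
      · rw [show blkStart n + 1 + (k + 1) = blkStart n + (k + 2) by omega,
          code_two z x n k (by omega)] at this
        simp at this
    subst hk'
    apply h
    rw [← hv.2.1, show blkStart (n + 1) + 1 + (n + 1) + 1 = blkStart (n + 1 + 1) by
      have := hst (n + 1); omega, alpha_zero]
  | sink t t' => exact hc.elim
  | scan q t => exact hc.elim
  | tst q b t h => exact hc.elim
  | mv q a i q' j w h hw => exact hc.elim

/-- One letter on tape 1 is read in the simulating part. -/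
theorem step_run (x y : ℕ → Option σ) (q : M.Q) (p1 p2 : ℕ) (c' : St M.Q × ℕ × ℕ)
    (h : CStep (theT z M) x y (St.run q, p1, p2) c') :
    (x p1 = some z ∧ c' = (St.run q, p1 + 1, p2 + 1)) ∨
    (x p1 = none ∧ c' = (St.test q (y p2).isSome, p1 + 1, p2 + 1)) := by
  obtain ⟨q', p1', p2'⟩ := c'
  obtain ⟨u, v, ht, hu, hv, h1, h2⟩ := h
  change Tr z M (St.run q) u v q' at ht
  simp only at hu hv h1 h2
  cases ht with
  | scan q t => exact Or.inl ⟨hu.1, by rw [h1, h2]; rfl⟩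
  | tst q b t hb => exact Or.inr ⟨hu.1, by rw [h1, h2, hb, ← hv.1]; rfl⟩

theorem step_test (x y : ℕ → Option σ) (q : M.Q) (i : Bool) (p1 p2 : ℕ) (c' : St M.Q × ℕ × ℕ)
    (h : CStep (theT z M) x y (St.test q i, p1, p2) c') :
    ∃ a q' j p2', x p1 = some a ∧ c' = (St.run q', p1 + 1, p2') ∧ (q, a, i, q', j) ∈ M.trans ∧
      (p2' : ℤ) = p2 + 1 + j := by
  obtain ⟨q', p1', p2'⟩ := c'
  obtain ⟨u, v, ht, hu, hv, h1, h2⟩ := h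
  change Tr z M (St.test q i) u v q' at ht
  simp only at hu hv h1 h2
  cases ht with
  | mv q a i q' j w h hw =>
    exact ⟨a, q', j, p2', hu.1, by rw [h1]; rfl, h, by rw [h2]; push_cast; omega⟩

/-- The effect of the simulating part on one block. -/
theorem block_step (x : ℕ → σ) (d : ℕ → St M.Q × ℕ × ℕ)
    (hd : ∀ i, CStep (theT z M) (code z x) (alphaWord z) (d i) (d (i + 1)))
    (n : ℕ) (q : M.Q) (c : ℕ) (hc : c ≤ n)
    (h0 : d (blkStart n) = (.run q, blkStart n, blkStart n + c)) :
    (∃ b, (d (blkStart n + 1)).1 = .test q b) ∧ ∃ q' c', c' ≤ n + 1 ∧ M.Step (x n) (q, c) (q', c') ∧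
      ∀ k ≤ n, d (blkStart n + 2 + k) =
        (.run q', blkStart n + 2 + k, blkStart n + 2 + k + c') := by
  have hd1 : d (blkStart n + 1) = (.test q (decide (c ≠ 0)), blkStart n + 1,
      blkStart n + c + 1) := by
    have := hd (blkStart n)
    rw [h0] at this
    rcases step_run z M _ _ _ _ _ _ this with ⟨h1, h2⟩ | ⟨h1, h2⟩
    · rw [code_zero] at h1; simp at h1
    · rw [h2]
      congr 2
      cases c with
      | zero => simp [alpha_zero]
      | succ c => rw [alpha_pos z n c (by omega)]; simp
  refine ⟨⟨_, by rw [hd1]⟩, ?_⟩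
  have h2 := hd (blkStart n + 1)
  rw [hd1] at h2
  obtain ⟨a, q', j, p2', ha, h3, htr, hp⟩ := step_test z M _ _ _ _ _ _ _ h2
  rw [code_one] at ha
  obtain rfl : x n = a := by simpa using ha
  have hm := M.transMoves _ htr
  have hz := M.transZero _ htr
  simp only at hm hz
  have hcj : 0 ≤ (c : ℤ) + j := by
    rcases Nat.eq_zero_or_pos c with hc0 | hc0
    · have := hz (by simp [hc0])
      omega
    · omega
  refine ⟨q', ((c : ℤ) + j).toNat, by omega, ⟨j, htr, ?_⟩, ?_⟩
  · simp only; omega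
  · intro k
    induction k with
    | zero =>
      intro _
      have : p2' = blkStart n + 2 + 0 + ((c : ℤ) + j).toNat := by push_cast at hp; omega
      rw [← this]
      exact h3
    | succ k ih =>
      intro hk
      have h4 := hd (blkStart n + 2 + k)
      rw [ih (by omega)] at h4
      rcases step_run z M _ _ _ _ _ _ h4 with ⟨h5, h6⟩ | ⟨h5, h6⟩
      · rw [← add_assoc, h6]
        congr 2
        omega
      · rw [show blkStart n + 2 + k = blkStart n + (k + 2) by omega,
          code_two z x n k (by omega)] at h5
        simp at h5

theorem M_of_acc (x : ℕ → σ) (h : (theT z M).Accepts (code z x) (alphaWord z)) :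
    M.Accepts x := by
  rw [accepts_iff] at h
  obtain ⟨d, h0, hs, ⟨qf, hqf, hinf⟩, -, -⟩ := h
  change ℕ → St M.Q × ℕ × ℕ at d
  change St M.Q at qf
  change d 0 = (St.start, 0, 0) at h0
  have hs0 := hs 0
  rw [h0] at hs0
  have hd1 : d 1 = (St.sync false, 0, 0) ∨ d 1 = (St.run M.init, 0, 0) := by
    rcases hd : d 1 with ⟨q', p1', p2'⟩
    rw [zero_add, hd] at hs0
    obtain ⟨u, v, ht, hu, hv, h1, h2⟩ := hs0
    change Tr z M St.start u v q' at ht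
    simp only at hu hv h1 h2
    cases ht with
    | start_sync => left; rw [h1, h2]; rfl
    | start_run => right; rw [h1, h2]; rfl
    | start_err a b c h =>
      exfalso
      apply h
      rw [← hv.1, ← hv.2.1, ← hv.2.2.1]
      exact ⟨alpha_zero z 0, alpha_pos z 0 0 (by omega), alpha_zero z 1⟩
  rcases hd1 with hd1 | hd1
  · exfalso
    have hI : ∀ n, ErrInv z M (d (n + 1)) := by
      intro n
      induction n with
      | zero => rw [zero_add, hd1]; exact ⟨rfl, rfl⟩
      | succ n ih => exact ErrInv.step z M x _ _ ih (hs (n + 1))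
    obtain ⟨m, hm, hm'⟩ := hinf 1
    obtain ⟨m, rfl⟩ := Nat.exists_eq_succ_of_ne_zero (by omega : m ≠ 0)
    have := hI m
    rcases hqf with rfl | ⟨q, -, rfl⟩
    · rw [show d (m + 1) = ((d (m + 1)).1, (d (m + 1)).2.1, (d (m + 1)).2.2) from rfl] at this
      rw [hm'] at this
      exact this
    · rw [show d (m + 1) = ((d (m + 1)).1, (d (m + 1)).2.1, (d (m + 1)).2.2) from rfl] at this
      rw [hm'] at this
      exact this
  · let e : ℕ → St M.Q × ℕ × ℕ := fun i => d (i + 1)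
    have he : ∀ i, CStep (theT z M) (code z x) (alphaWord z) (e i) (e (i + 1)) :=
      fun i => hs (i + 1)
    have hst : ∀ n, blkStart (n + 1) = blkStart n + 2 + n := fun n => by rw [blkStart]; omega
    have hex : ∀ n, ∃ r : M.Q × ℕ, r.2 ≤ n ∧
        e (blkStart n) = (.run r.1, blkStart n, blkStart n + r.2) := by
      intro n
      induction n with
      | zero => exact ⟨(M.init, 0), le_rfl, hd1⟩
      | succ n ih =>
        obtain ⟨⟨q, c⟩, hc, hq⟩ := ih
        obtain ⟨-, q', c', hc', -, h3⟩ := block_step z M x e he n q c hc hq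
        exact ⟨(q', c'), hc', by rw [hst]; exact h3 n le_rfl⟩
    choose r hr1 hr2 using hex
    have hblk : ∀ n, M.Step (x n) (r n) (r (n + 1)) ∧ (∃ b, (e (blkStart n + 1)).1 = .test (r n).1 b)
        ∧ ∀ k ≤ n, (e (blkStart n + 2 + k)).1 = .run (r (n + 1)).1 := by
      intro n
      obtain ⟨h1, q', c', hc', h2, h3⟩ := block_step z M x e he n (r n).1 (r n).2 (hr1 n) (hr2 n)
      have h4 := hr2 (n + 1)
      rw [hst, h3 n le_rfl] at h4
      simp only [Prod.mk.injEq, St.run.injEq, true_and] at h4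
      have h5 : r (n + 1) = (q', c') := Prod.ext h4.1.symm (by simp only; omega)
      rw [h5]
      exact ⟨h2, h1, fun k hk => by rw [h3 k hk]⟩
    refine ⟨r, ?_, fun n => (hblk n).1, ?_⟩
    · have h4 := hr2 0
      have h5 : e (blkStart 0) = (.run M.init, 0, 0) := hd1
      rw [h5] at h4
      simp only [blkStart, Prod.mk.injEq, St.run.injEq, true_and] at h4
      exact Prod.ext h4.1.symm (by simp only; omega)
    · -- the accepting state
      have hrun : ∀ i, (e i).1 ≠ St.sink := by
        intro i hi
        obtain ⟨n, k, hk, rfl⟩ := exists_blk i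
        match k, hk with
        | 0, _ => rw [add_zero, hr2] at hi; simp at hi
        | 1, _ =>
          obtain ⟨b, hb⟩ := (hblk n).2.1
          rw [hb] at hi; simp at hi
        | k + 2, hk =>
          rw [show blkStart n + (k + 2) = blkStart n + 2 + k by omega,
            (hblk n).2.2 k (by omega)] at hi
          simp at hi
      have hinf' : ∀ n, ∃ m, n ≤ m ∧ (e m).1 = qf := by
        intro n
        obtain ⟨m, hm, hm'⟩ := hinf (n + 1)
        obtain ⟨m, rfl⟩ := Nat.exists_eq_succ_of_ne_zero (by omega : m ≠ 0)
        exact ⟨m, by omega, hm'⟩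
      rcases hqf with rfl | ⟨q, hq, rfl⟩
      · obtain ⟨m, -, hm⟩ := hinf' 0
        exact absurd hm (hrun m)
      · refine ⟨q, hq, fun N => ?_⟩
        obtain ⟨i, hi, hi'⟩ := hinf' (blkStart N)
        obtain ⟨n, k, hk, rfl⟩ := exists_blk i
        have hNn : N ≤ n := by
          by_contra hlt
          have := blkStart_mono (show n + 1 ≤ N by omega)
          rw [hst] at this
          omega
        match k, hk with
        | 0, _ =>
          rw [add_zero, hr2] at hi'
          exact ⟨n, hNn, by simpa using hi'⟩
        | 1, _ =>
          obtain ⟨b, hb⟩ := (hblk n).2.1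
          rw [hb] at hi'; simp at hi'
        | k + 2, hk =>
          rw [show blkStart n + (k + 2) = blkStart n + 2 + k by omega,
            (hblk n).2.2 k (by omega)] at hi'
          exact ⟨n + 1, by omega, by simpa using hi'⟩

end

/-- For a countable ordinal `γ ≥ 2`: if some `Π⁰_γ`-complete
(resp. `Σ⁰_γ`-complete) `L ⊆ Σ^ω` is accepted by a real-time Büchi 1-counter
automaton, then there is an infinitary rational relation `R ⊆ Γ^ω × Γ^ω` (with
`Γ = Σ ∪ {A}`) with exactly one nontrivial section: the section
`R_{α₀} = {σ' ∈ Γ^ω : (σ', α₀) ∈ R}` is a `Π⁰_γ`-complete (resp.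
`Σ⁰_γ`-complete) subset of `Γ^ω`, and for every `u ∈ Γ^ω` with `u ≠ α₀` the
section `R_u` equals `Γ^ω` (the boolean `b` selects the class: `true` for
`Σ⁰_γ`, `false` for `Π⁰_γ`). -/
theorem exists_ratRel_sections (σ : Type) [Fintype σ] [Nonempty σ]
    [TopologicalSpace σ] [DiscreteTopology σ] (z : σ)
    (γ : Ordinal.{0}) (hγ : 2 ≤ γ) (hcount : γ.card ≤ Cardinal.aleph0) (b : Bool)
    (hex : ∃ (L : Set (ℕ → σ)) (M : OneCounterBuchi σ),
      L = {x | M.Accepts x} ∧ IsCompleteFor b γ L) :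
    ∃ R : Set ((ℕ → Option σ) × (ℕ → Option σ)),
      IsRatRel R ∧
      IsCompleteFor b γ {s : ℕ → Option σ | (s, alphaWord z) ∈ R} ∧
      ∀ u : ℕ → Option σ, u ≠ alphaWord z →
        {s : ℕ → Option σ | (s, u) ∈ R} = Set.univ := by
  obtain ⟨L, M, rfl, hL⟩ := hex
  refine ⟨{p | (theT z M).Accepts p.1 p.2}, ⟨theT z M, fun p => Iff.rfl⟩, ?_, ?_⟩
  · refine complete_transfer hγ b hL (code z) (decode z) (continuous_code z) (continuous_decode z)
      (decode_code z) _ ?_ ?_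
    · intro x
      exact ⟨M_of_acc z M x, acc_of_M z M x⟩
    · intro y hy
      exact acc_of_not z M y _ fun h => hy h.2
  · intro u hu
    ext s
    simp only [Set.mem_ofPred_eq, Set.mem_univ, iff_true]
    exact acc_of_not z M s u fun h => hu h.1
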